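/- arXiv:math/9906101 — 7 statements merged into one kernel-verified Lean document; each statement's English description precedes it below -/
import Mathlib

section
/- Let v = a·V₊ + b·V₋ + c·W₊ + d·W₋ be an element of the odd part G₁ of osp(2|2), with a, b, c, d ∈ ℂ. If μ(v, v) = 0, then either a = b = 0 or c = d = 0; that is, v lies in the span of {V₊, V₋} or in the span of {W₊, W₋}. -/
noncomputable section

open scoped BigOperators

/-- The underlying vector space of `osp(2|2)`, with coordinates in the basis
`(g₀,…,g₇) = (H, X₊, X₋, B, V₊, V₋, W₊, W₋)`. -/
abbrev G := Fin 8 → ℂ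

/-- `G ⊗ G`, represented by coefficient matrices in the basis `gᵢ ⊗ gⱼ`. -/
abbrev TT := Fin 8 → Fin 8 → ℂ

/-- The grade: `H, X₊, X₋, B` are even (0); `V₊, V₋, W₊, W₋` are odd (1). -/
def gr (i : Fin 8) : ℕ := if i.val < 4 then 0 else 1

/-- The sign `z(i,j) = (−1)^{|i||j|}`. -/
def zz (i j : Fin 8) : ℂ := (-1 : ℂ) ^ (gr i * gr j)

/-- Structure constants of `osp(2|2)` (on `ℕ` indices, 0 outside the table). -/
def cNat : ℕ → ℕ → ℕ → ℂ
  | 0,1,1 => 1 | 1,0,1 => -1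
  | 0,2,2 => -1 | 2,0,2 => 1
  | 1,2,0 => -2 | 2,1,0 => 2
  | 0,4,4 => 1/2 | 4,0,4 => -1/2
  | 0,5,5 => -1/2 | 5,0,5 => 1/2
  | 0,6,6 => 1/2 | 6,0,6 => -1/2
  | 0,7,7 => -1/2 | 7,0,7 => 1/2
  | 3,4,4 => 1/2 | 4,3,4 => -1/2
  | 3,5,5 => 1/2 | 5,3,5 => -1/2
  | 3,6,6 => -1/2 | 6,3,6 => 1/2
  | 3,7,7 => -1/2 | 7,3,7 => 1/2
  | 1,5,4 => -1 | 5,1,4 => 1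
  | 2,4,5 => 1 | 4,2,5 => -1
  | 1,7,6 => -1 | 7,1,6 => 1
  | 2,6,7 => 1 | 6,2,7 => -1
  | 4,7,0 => 1 | 4,7,3 => -1 | 7,4,0 => 1 | 7,4,3 => -1
  | 6,5,0 => 1 | 6,5,3 => 1 | 5,6,0 => 1 | 5,6,3 => 1
  | 4,6,1 => 1 | 6,4,1 => 1
  | 5,7,2 => 1 | 7,5,2 => 1
  | _,_,_ => 0

/-- Structure constants `c i j k`, so that `μ(gᵢ,gⱼ) = Σ_k c i j k • g_k`. -/
def c (i j k : Fin 8) : ℂ := cNat i.val j.val k.val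

/-- The bracket `μ` of `osp(2|2)`, extended bilinearly from the basis. -/
def mu (u v : G) : G := fun k => ∑ i, ∑ j, u i * v j * c i j k

/-- The basis vectors `g₀,…,g₇`. -/
def e (i : Fin 8) : G := Pi.single i 1

/-- Membership in the even part `G₀ = span{H, X₊, X₋, B}`. -/
def isEven (v : G) : Prop := ∀ i : Fin 8, 4 ≤ i.val → v i = 0

/-- Membership in the odd part `G₁ = span{V₊, V₋, W₊, W₋}`. -/
def isOdd (v : G) : Prop := ∀ i : Fin 8, i.val < 4 → v i = 0

/-- if `v = a·V₊ + b·V₋ + c·W₊ + d·W₋` satisfies `μ(v,v) = 0`, then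
`a = b = 0` or `c = d = 0`. -/
theorem stmt0 (a b cc dd : ℂ)
    (h : mu (a • e 4 + b • e 5 + cc • e 6 + dd • e 7)
      (a • e 4 + b • e 5 + cc • e 6 + dd • e 7) = 0) :
    (a = 0 ∧ b = 0) ∨ (cc = 0 ∧ dd = 0) := by
  have hv : a • e 4 + b • e 5 + cc • e 6 + dd • e 7 = ![0, 0, 0, 0, a, b, cc, dd] := by
    funext i
    fin_cases i <;> simp [e, Pi.single_apply]
  rw [hv] at h
  have key : ∀ k : Fin 8,
      a * a * c 4 4 k + a * b * (c 4 5 k + c 5 4 k) + b * b * c 5 5 k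
      + cc * cc * c 6 6 k + cc * dd * (c 6 7 k + c 7 6 k) + dd * dd * c 7 7 k
      + a * cc * (c 4 6 k + c 6 4 k) + a * dd * (c 4 7 k + c 7 4 k)
      + b * cc * (c 5 6 k + c 6 5 k) + b * dd * (c 5 7 k + c 7 5 k) = 0 := by
    intro k
    have hk := congrFun h k
    simp only [mu, Fin.sum_univ_eight] at hk
    simp at hk
    linear_combination hk
  have h0 := key 0
  have h1 := key 1
  have h2 := key 2
  have h3 := key 3
  rw [(show c 4 4 0 = 0 from rfl), (show c 4 5 0 = 0 from rfl), (show c 4 6 0 = 0 from rfl), (show c 4 7 0 = 1 from rfl), (show c 5 4 0 = 0 from rfl), (show c 5 5 0 = 0 from rfl), (show c 5 6 0 = 1 from rfl), (show c 5 7 0 = 0 from rfl), (show c 6 4 0 = 0 from rfl), (show c 6 5 0 = 1 from rfl), (show c 6 6 0 = 0 from rfl), (show c 6 7 0 = 0 from rfl), (show c 7 4 0 = 1 from rfl), (show c 7 5 0 = 0 from rfl), (show c 7 6 0 = 0 from rfl), (show c 7 7 0 = 0 from rfl)] at h0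
  rw [(show c 4 4 1 = 0 from rfl), (show c 4 5 1 = 0 from rfl), (show c 4 6 1 = 1 from rfl), (show c 4 7 1 = 0 from rfl), (show c 5 4 1 = 0 from rfl), (show c 5 5 1 = 0 from rfl), (show c 5 6 1 = 0 from rfl), (show c 5 7 1 = 0 from rfl), (show c 6 4 1 = 1 from rfl), (show c 6 5 1 = 0 from rfl), (show c 6 6 1 = 0 from rfl), (show c 6 7 1 = 0 from rfl), (show c 7 4 1 = 0 from rfl), (show c 7 5 1 = 0 from rfl), (show c 7 6 1 = 0 from rfl), (show c 7 7 1 = 0 from rfl)] at h1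
  rw [(show c 4 4 2 = 0 from rfl), (show c 4 5 2 = 0 from rfl), (show c 4 6 2 = 0 from rfl), (show c 4 7 2 = 0 from rfl), (show c 5 4 2 = 0 from rfl), (show c 5 5 2 = 0 from rfl), (show c 5 6 2 = 0 from rfl), (show c 5 7 2 = 1 from rfl), (show c 6 4 2 = 0 from rfl), (show c 6 5 2 = 0 from rfl), (show c 6 6 2 = 0 from rfl), (show c 6 7 2 = 0 from rfl), (show c 7 4 2 = 0 from rfl), (show c 7 5 2 = 1 from rfl), (show c 7 6 2 = 0 from rfl), (show c 7 7 2 = 0 from rfl)] at h2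
  rw [(show c 4 4 3 = 0 from rfl), (show c 4 5 3 = 0 from rfl), (show c 4 6 3 = 0 from rfl), (show c 4 7 3 = -1 from rfl), (show c 5 4 3 = 0 from rfl), (show c 5 5 3 = 0 from rfl), (show c 5 6 3 = 1 from rfl), (show c 5 7 3 = 0 from rfl), (show c 6 4 3 = 0 from rfl), (show c 6 5 3 = 1 from rfl), (show c 6 6 3 = 0 from rfl), (show c 6 7 3 = 0 from rfl), (show c 7 4 3 = -1 from rfl), (show c 7 5 3 = 0 from rfl), (show c 7 6 3 = 0 from rfl), (show c 7 7 3 = 0 from rfl)] at h3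
  have k1 : a * cc = 0 := by linear_combination h1 / 2
  have k2 : b * dd = 0 := by linear_combination h2 / 2
  have k3 : a * dd = 0 := by linear_combination (h0 - h3) / 4
  have k4 : b * cc = 0 := by linear_combination (h0 + h3) / 4
  by_cases ha : a = 0
  · by_cases hb : b = 0
    · exact Or.inl ⟨ha, hb⟩
    · exact Or.inr ⟨(mul_eq_zero.mp k4).resolve_left hb, (mul_eq_zero.mp k2).resolve_left hb⟩
  · exact Or.inr ⟨(mul_eq_zero.mp k1).resolve_left ha, (mul_eq_zero.mp k3).resolve_left ha⟩

end
end

section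
/- (Lemma 1) Let A be an even automorphism of osp(2|2). Then the restriction of A to the odd part G₁ is, with respect to the decomposition G₁ = span{V₊,V₋} ⊕ span{W₊,W₋}, either block diagonal or block antidiagonal; that is, either A maps span{V₊,V₋} into span{V₊,V₋} and span{W₊,W₋} into span{W₊,W₋}, or A maps span{V₊,V₋} into span{W₊,W₋} and span{W₊,W₋} into span{V₊,V₋}. -/
noncomputable section

open scoped BigOperators

/-- An even automorphism of `osp(2|2)`: a bijective linear map preserving the
grading and the bracket. -/
def IsEvenAut (A : G →ₗ[ℂ] G) : Prop :=
  Function.Bijective A ∧ (∀ v, isEven v → isEven (A v)) ∧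
    (∀ v, isOdd v → isOdd (A v)) ∧ ∀ x y, A (mu x y) = mu (A x) (A y)

/-- Membership in `span{V₊, V₋}`. -/
def inV (v : G) : Prop := ∀ i : Fin 8, i.val ≠ 4 → i.val ≠ 5 → v i = 0

/-- Membership in `span{W₊, W₋}`. -/
def inW (v : G) : Prop := ∀ i : Fin 8, i.val ≠ 6 → i.val ≠ 7 → v i = 0

set_option maxHeartbeats 4000000 in
/-- Bracket of a vector supported on `B`. -/
theorem mu_B (u v : G) (hu : ∀ i : Fin 8, i ≠ 3 → u i = 0) :
    mu u v = ![0, 0, 0, 0, u 3 * v 4 / 2, u 3 * v 5 / 2, -(u 3 * v 6 / 2), -(u 3 * v 7 / 2)] := by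
  have h : ∀ k, mu u v k = ∑ j, u 3 * v j * c 3 j k := by
    intro k
    unfold mu
    refine Finset.sum_eq_single 3 (fun i _ hi => ?_) (fun h => absurd (Finset.mem_univ _) h)
    simp [hu i hi]
  funext k
  rw [h]
  fin_cases k <;> simp [Fin.sum_univ_eight, c, cNat] <;> ring

theorem mu_e0_1 (u : G) : mu u (e 0) 1 = -u 1 := by
  simp [mu, Fin.sum_univ_eight, c, cNat, e, Pi.single_apply]

theorem mu_e0_2 (u : G) : mu u (e 0) 2 = u 2 := by
  simp [mu, Fin.sum_univ_eight, c, cNat, e, Pi.single_apply]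

theorem mu_e1_1 (u : G) : mu u (e 1) 1 = u 0 := by
  simp [mu, Fin.sum_univ_eight, c, cNat, e, Pi.single_apply]

/-- Lemma 1: an even automorphism of `osp(2|2)` is block diagonal or
block antidiagonal on `G₁ = span{V₊,V₋} ⊕ span{W₊,W₋}`. -/
theorem stmt2 (A : G →ₗ[ℂ] G) (hA : IsEvenAut A) :
    ((∀ v, inV v → inV (A v)) ∧ (∀ v, inW v → inW (A v))) ∨
    ((∀ v, inV v → inW (A v)) ∧ (∀ v, inW v → inV (A v))) := by
  obtain ⟨⟨hinj, hsurj⟩, hev, hodd, hmu⟩ := hA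
  have he3 : ∀ i : Fin 8, i ≠ 3 → e 3 i = 0 := fun i hi => by simp [e, Pi.single_apply, hi]
  have he33 : e 3 3 = 1 := by simp [e]
  -- brackets with the image of `B` are odd
  have key : ∀ x, isOdd (mu (A (e 3)) x) := by
    intro x
    obtain ⟨y, rfl⟩ := hsurj x
    rw [← hmu]
    apply hodd
    rw [mu_B _ _ he3]
    intro i hi
    fin_cases i <;> simp at hi ⊢
  have hAe := hev (e 3) (fun i hi => he3 i (by rintro rfl; simp at hi))
  have hB : ∀ i : Fin 8, i ≠ 3 → A (e 3) i = 0 := by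
    have h1 := key (e 0) 1 (by decide)
    have h2 := key (e 0) 2 (by decide)
    have h0 := key (e 1) 1 (by decide)
    rw [mu_e0_1] at h1
    rw [mu_e0_2] at h2
    rw [mu_e1_1] at h0
    intro i hi
    by_cases h4 : 4 ≤ i.val
    · exact hAe i h4
    · fin_cases i
      · exact h0
      · exact neg_eq_zero.mp h1
      · exact h2
      all_goals simp at hi h4
  set b := A (e 3) 3 with hb
  -- the eigenvalue equations on the two blocks
  have hV : ∀ v, inV v → ∀ k, mu (A (e 3)) (A v) k = (1 / 2) * A v k := by
    intro v hv k
    have : mu (e 3) v = (1 / 2 : ℂ) • v := by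
      rw [mu_B _ _ he3, he33]
      funext i
      have := hv i
      fin_cases i <;> simp at this <;> simp [this, hv 6, hv 7] <;> ring
    rw [← hmu, this, map_smul]; simp
  have hW : ∀ v, inW v → ∀ k, mu (A (e 3)) (A v) k = -(1 / 2) * A v k := by
    intro v hv k
    have : mu (e 3) v = (-(1 / 2) : ℂ) • v := by
      rw [mu_B _ _ he3, he33]
      funext i
      have := hv i
      fin_cases i <;> simp at this <;> simp [this, hv 4, hv 5] <;> ring
    rw [← hmu, this, map_smul]; simp
  have oV : ∀ v, inV v → isOdd (A v) := fun v hv =>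
    hodd v fun i hi => hv i (by omega) (by omega)
  have oW : ∀ v, inW v → isOdd (A v) := fun v hv =>
    hodd v fun i hi => hv i (by omega) (by omega)
  have eqV : ∀ v, inV v → (b - 1) * A v 4 = 0 ∧ (b - 1) * A v 5 = 0 ∧
      (b + 1) * A v 6 = 0 ∧ (b + 1) * A v 7 = 0 := by
    intro v hv
    have h := hV v hv
    rw [mu_B _ _ hB] at h
    have h4 := h 4
    have h5 := h 5
    have h6 := h 6
    have h7 := h 7
    simp [← hb] at h4 h5 h6 h7
    refine ⟨?_, ?_, ?_, ?_⟩
    · linear_combination 2 * h4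
    · linear_combination 2 * h5
    · linear_combination -2 * h6
    · linear_combination -2 * h7
  have eqW : ∀ v, inW v → (b + 1) * A v 4 = 0 ∧ (b + 1) * A v 5 = 0 ∧
      (b - 1) * A v 6 = 0 ∧ (b - 1) * A v 7 = 0 := by
    intro v hv
    have h := hW v hv
    rw [mu_B _ _ hB] at h
    have h4 := h 4
    have h5 := h 5
    have h6 := h 6
    have h7 := h 7
    simp [← hb] at h4 h5 h6 h7
    refine ⟨?_, ?_, ?_, ?_⟩
    · linear_combination 2 * h4
    · linear_combination 2 * h5
    · linear_combination 2 * h6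
    · linear_combination 2 * h7
  have mkV : ∀ w : G, isOdd w → w 6 = 0 → w 7 = 0 → inV w := by
    intro w hw h6 h7 i hi4 hi5
    by_cases h : i.val < 4
    · exact hw i h
    · fin_cases i <;> simp at hi4 hi5 h <;> assumption
  have mkW : ∀ w : G, isOdd w → w 4 = 0 → w 5 = 0 → inW w := by
    intro w hw h6 h7 i hi4 hi5
    by_cases h : i.val < 4
    · exact hw i h
    · fin_cases i <;> simp at hi4 hi5 h <;> assumption
  by_cases hm : b + 1 = 0
  · right
    have h2 : b - 1 ≠ 0 := by
      intro h
      have : (2 : ℂ) = 0 := by linear_combination hm - h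
      norm_num at this
    refine ⟨fun v hv => ?_, fun v hv => ?_⟩
    · obtain ⟨h4, h5, -, -⟩ := eqV v hv
      exact mkW _ (oV v hv) ((mul_eq_zero.mp h4).resolve_left h2)
        ((mul_eq_zero.mp h5).resolve_left h2)
    · obtain ⟨-, -, h6, h7⟩ := eqW v hv
      exact mkV _ (oW v hv) ((mul_eq_zero.mp h6).resolve_left h2)
        ((mul_eq_zero.mp h7).resolve_left h2)
  · left
    refine ⟨fun v hv => ?_, fun v hv => ?_⟩
    · obtain ⟨-, -, h6, h7⟩ := eqV v hv
      exact mkV _ (oV v hv) ((mul_eq_zero.mp h6).resolve_left hm)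
        ((mul_eq_zero.mp h7).resolve_left hm)
    · obtain ⟨h4, h5, -, -⟩ := eqW v hv
      exact mkW _ (oW v hv) ((mul_eq_zero.mp h4).resolve_left hm)
        ((mul_eq_zero.mp h5).resolve_left hm)


end
end

section
/- (Lemma 2) Let A be an even automorphism of osp(2|2) whose restriction to G₁ is block diagonal: A V₊ = a V₊ + b V₋, A V₋ = c V₊ + d V₋, A W₊ = x W₊ + y W₋, A W₋ = z W₊ + t W₋ for complex numbers a,b,c,d,x,y,z,t. Then the matrix (a,b;c,d) equals (ad − bc) times the matrix (x,y;z,t), i.e. a = (ad−bc)x, b = (ad−bc)y, c = (ad−bc)z, d = (ad−bc)t. -/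
noncomputable section

open scoped BigOperators

set_option maxHeartbeats 4000000 in
theorem inner_mu (a b x y : ℂ) : mu (a • e 4 + b • e 5) (x • e 6 + y • e 7) =
    ![a * y + b * x, a * x, b * y, b * x - a * y, 0, 0, 0, 0] := by
  funext k
  fin_cases k <;> simp [mu, e, Fin.sum_univ_eight] <;> simp [c, cNat] <;> ring

set_option maxHeartbeats 4000000 in
theorem outer_mu (a b x y p q : ℂ) :
    mu (mu (a • e 4 + b • e 5) (x • e 6 + y • e 7)) (p • e 4 + q • e 5) =
    (-((a * q - b * p) * x)) • e 4 + (-((a * q - b * p) * y)) • e 5 := by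
  rw [inner_mu]
  funext k
  fin_cases k <;> simp [mu, e, Fin.sum_univ_eight] <;> simp [c, cNat] <;> ring

/-- Lemma 2: for a block-diagonal even automorphism, the `V`-block equals
`(ad − bc)` times the `W`-block. -/
theorem stmt3 (A : G →ₗ[ℂ] G) (hA : IsEvenAut A) (a b cc dd x y zc t : ℂ)
    (h4 : A (e 4) = a • e 4 + b • e 5) (h5 : A (e 5) = cc • e 4 + dd • e 5)
    (h6 : A (e 6) = x • e 6 + y • e 7) (h7 : A (e 7) = zc • e 6 + t • e 7) :
    a = (a * dd - b * cc) * x ∧ b = (a * dd - b * cc) * y ∧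
      cc = (a * dd - b * cc) * zc ∧ dd = (a * dd - b * cc) * t := by
  obtain ⟨-, -, -, hm⟩ := hA
  have h1 := outer_mu 1 0 1 0 0 1
  have h2 := outer_mu 0 1 0 1 1 0
  simp only [one_smul, zero_smul, add_zero, zero_add] at h1 h2
  have k1 := congrArg A h1
  have k2 := congrArg A h2
  rw [hm, hm, h4, h5, h6, outer_mu, map_add, map_smul, map_smul, h4, h5] at k1
  rw [hm, hm, h4, h5, h7, outer_mu, map_add, map_smul, map_smul, h4, h5] at k2
  have p1 := congrFun k1 4
  have p2 := congrFun k1 5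
  have p3 := congrFun k2 4
  have p4 := congrFun k2 5
  simp [e, Pi.single_apply] at p1 p2 p3 p4
  refine ⟨?_, ?_, ?_, ?_⟩
  · linear_combination -p1
  · linear_combination -p2
  · linear_combination -p3
  · linear_combination -p4

end
end

section
/- (Lemma 3) Let A be an even automorphism of osp(2|2). Then there exist complex numbers a, b, c, d with k := ad − bc ≠ 0 and m ∈ {0,1} such that the restriction of A to G₁ is given as follows: if m = 0 then A V₊ = a V₊ + b V₋, A V₋ = c V₊ + d V₋, A W₊ = (a W₊ + b W₋)/k, A W₋ = (c W₊ + d W₋)/k; if m = 1 then A V₊ = (a W₊ + b W₋)/k, A V₋ = (c W₊ + d W₋)/k, A W₊ = a V₊ + b V₋, A W₋ = c V₊ + d V₋. -/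
noncomputable section

open scoped BigOperators

set_option maxHeartbeats 4000000 in
/-- The bracket in coordinates. -/
theorem mu_coords (u v : G) :
    mu u v 0 = -2*u 1*v 2 + 2*u 2*v 1 + u 4*v 7 + u 7*v 4 + u 6*v 5 + u 5*v 6 ∧
    mu u v 1 = u 0*v 1 - u 1*v 0 + u 4*v 6 + u 6*v 4 ∧
    mu u v 2 = -u 0*v 2 + u 2*v 0 + u 5*v 7 + u 7*v 5 ∧
    mu u v 3 = -u 4*v 7 - u 7*v 4 + u 6*v 5 + u 5*v 6 ∧
    mu u v 4 = u 0*v 4/2 - u 4*v 0/2 + u 3*v 4/2 - u 4*v 3/2 - u 1*v 5 + u 5*v 1 ∧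
    mu u v 5 = -u 0*v 5/2 + u 5*v 0/2 + u 3*v 5/2 - u 5*v 3/2 + u 2*v 4 - u 4*v 2 ∧
    mu u v 6 = u 0*v 6/2 - u 6*v 0/2 - u 3*v 6/2 + u 6*v 3/2 - u 1*v 7 + u 7*v 1 ∧
    mu u v 7 = -u 0*v 7/2 + u 7*v 0/2 - u 3*v 7/2 + u 7*v 3/2 + u 2*v 6 - u 6*v 2 := by
  refine ⟨?_, ?_, ?_, ?_, ?_, ?_, ?_, ?_⟩ <;>
    simp [mu, Fin.sum_univ_eight, c, cNat] <;> ring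

theorem e_apply (i j : Fin 8) : e i j = if j = i then 1 else 0 := by
  simp [e, Pi.single_apply]

theorem G_ext {u v : G} (h0 : u 0 = v 0) (h1 : u 1 = v 1) (h2 : u 2 = v 2) (h3 : u 3 = v 3)
    (h4 : u 4 = v 4) (h5 : u 5 = v 5) (h6 : u 6 = v 6) (h7 : u 7 = v 7) : u = v := by
  funext i; fin_cases i <;> assumption

theorem even_iff (v : G) : isEven v ↔ v 4 = 0 ∧ v 5 = 0 ∧ v 6 = 0 ∧ v 7 = 0 := by
  constructor
  · intro h; exact ⟨h 4 (by decide), h 5 (by decide), h 6 (by decide), h 7 (by decide)⟩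
  · rintro ⟨h4, h5, h6, h7⟩ i hi
    fin_cases i <;> simp_all

theorem odd_iff (v : G) : isOdd v ↔ v 0 = 0 ∧ v 1 = 0 ∧ v 2 = 0 ∧ v 3 = 0 := by
  constructor
  · intro h; exact ⟨h 0 (by decide), h 1 (by decide), h 2 (by decide), h 3 (by decide)⟩
  · rintro ⟨h4, h5, h6, h7⟩ i hi
    fin_cases i <;> simp_all

theorem even_preimage (A : G →ₗ[ℂ] G) (hA : IsEvenAut A) (w : G) (hw : isEven w) :
    ∃ v, isEven v ∧ A v = w := by
  obtain ⟨⟨hinj, hsurj⟩, hev, hod, hm⟩ := hA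
  obtain ⟨v, hv⟩ := hsurj w
  let v0 : G := fun i => if i.val < 4 then v i else 0
  let v1 : G := fun i => if i.val < 4 then 0 else v i
  have hs : v = v0 + v1 := by
    funext i; by_cases h : i.val < 4 <;> simp [v0, v1, h]
  have h0 : isEven v0 := fun i hi => by simp [v0, not_lt.mpr hi]
  have h1 : isOdd v1 := fun i hi => by simp [v1, hi]
  refine ⟨v0, h0, ?_⟩
  have hA0 := hev _ h0
  have hA1 := hod _ h1
  rw [hs, map_add] at hv
  funext i
  have hvi := congrFun hv i
  simp only [Pi.add_apply] at hvi
  by_cases h : i.val < 4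
  · rw [hA1 i h, add_zero] at hvi; exact hvi
  · rw [hA0 i (not_lt.mp h), hw i (not_lt.mp h)]

theorem A_B (A : G →ₗ[ℂ] G) (hA : IsEvenAut A) : A (e 3) = (A (e 3) 3) • e 3 := by
  have hev : isEven (A (e 3)) := hA.2.1 _ (by rw [even_iff]; simp [e_apply])
  have key : ∀ w, isEven w → mu (A (e 3)) w = 0 := by
    intro w hw
    obtain ⟨v, hv, rfl⟩ := even_preimage A hA w hw
    rw [← hA.2.2.2]
    have : mu (e 3) v = 0 := by
      obtain ⟨h0, h1, h2, h3, h4, h5, h6, h7⟩ := mu_coords (e 3) v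
      rw [even_iff] at hv
      obtain ⟨k4, k5, k6, k7⟩ := hv
      apply G_ext <;> simp [*, e_apply]
    rw [this, map_zero]
  rw [even_iff] at hev
  obtain ⟨k4, k5, k6, k7⟩ := hev
  have E0 := key (e 0) (by rw [even_iff]; simp [e_apply])
  have E1 := key (e 1) (by rw [even_iff]; simp [e_apply])
  obtain ⟨-, h1, h2, -⟩ := mu_coords (A (e 3)) (e 0)
  obtain ⟨-, h1', -⟩ := mu_coords (A (e 3)) (e 1)
  rw [E0] at h1 h2
  rw [E1] at h1'
  simp [e_apply] at h1 h2 h1'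
  symm at h2 h1'
  apply G_ext <;> simp [*, e_apply]

theorem alg (a b c d p q r s : ℂ) (h1 : b*p = a*q) (h2 : d*r = c*s) (h3 : p*c = a*r)
    (h4 : q*d = b*s) (h5 : p*d + q*c = a*s + b*r) (h6 : p*d - q*c + a*s - b*r = 2)
    : a*d - b*c ≠ 0 ∧ p = a/(a*d-b*c) ∧ q = b/(a*d-b*c) ∧ r = c/(a*d-b*c)
      ∧ s = d/(a*d-b*c) := by
  have e1 : p*(a*d-b*c) = a := by grind
  have e2 : q*(a*d-b*c) = b := by grind
  have e3 : r*(a*d-b*c) = c := by grind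
  have e4 : s*(a*d-b*c) = d := by grind
  have hk : a*d-b*c ≠ 0 := by
    intro h
    rw [h] at e1 e2 e3 e4
    simp only [mul_zero] at e1 e2 e3 e4
    simp [← e1, ← e2, ← e3, ← e4] at h5 h6
  exact ⟨hk, by field_simp; grind, by field_simp; grind, by field_simp; grind, by field_simp; grind⟩

theorem mu_even_even (u v : G) (hu : isEven u) (hv : isEven v) : mu u v 3 = 0 := by
  rw [even_iff] at hu hv
  rw [(mu_coords u v).2.2.2.1]; simp [hu, hv]

set_option maxHeartbeats 4000000 in
/-- Lemma 3: every even automorphism of `osp(2|2)` acts on the odd part by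
the standard two-parameter-family form, for some `a,b,c,d` with `k = ad − bc ≠ 0` and
`m ∈ {0,1}`. -/
theorem stmt4 (A : G →ₗ[ℂ] G) (hA : IsEvenAut A) :
    ∃ (a b cc dd : ℂ) (m : Fin 2), a * dd - b * cc ≠ 0 ∧
      (m = 0 →
        A (e 4) = a • e 4 + b • e 5 ∧
        A (e 5) = cc • e 4 + dd • e 5 ∧
        A (e 6) = (a / (a * dd - b * cc)) • e 6 + (b / (a * dd - b * cc)) • e 7 ∧
        A (e 7) = (cc / (a * dd - b * cc)) • e 6 + (dd / (a * dd - b * cc)) • e 7) ∧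
      (m = 1 →
        A (e 4) = (a / (a * dd - b * cc)) • e 6 + (b / (a * dd - b * cc)) • e 7 ∧
        A (e 5) = (cc / (a * dd - b * cc)) • e 6 + (dd / (a * dd - b * cc)) • e 7 ∧
        A (e 6) = a • e 4 + b • e 5 ∧
        A (e 7) = cc • e 4 + dd • e 5) := by
  have hB := A_B A hA
  obtain ⟨⟨hinj, hsurj⟩, hev, hod, hm⟩ := hA
  set l := A (e 3) 3 with hl
  have ev : ∀ i : Fin 8, i.val < 4 → isEven (A (e i)) := by
    intro i hi
    apply hev
    intro j hj
    have : j ≠ i := by rintro rfl; omega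
    simp [e_apply, this]
  have od : ∀ i : Fin 8, 4 ≤ i.val → isOdd (A (e i)) := by
    intro i hi
    apply hod
    intro j hj
    have : j ≠ i := by rintro rfl; omega
    simp [e_apply, this]
  have o4 := (odd_iff _).1 (od 4 (by decide))
  have o5 := (odd_iff _).1 (od 5 (by decide))
  have o6 := (odd_iff _).1 (od 6 (by decide))
  have o7 := (odd_iff _).1 (od 7 (by decide))
  -- basis brackets
  have b01 : mu (e 0) (e 1) = e 1 := by
    obtain ⟨h0, h1, h2, h3, h4, h5, h6, h7⟩ := mu_coords (e 0) (e 1)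
    apply G_ext <;> simp [*, e_apply]
  have b02 : mu (e 0) (e 2) = -e 2 := by
    obtain ⟨h0, h1, h2, h3, h4, h5, h6, h7⟩ := mu_coords (e 0) (e 2)
    apply G_ext <;> simp [*, e_apply]
  have b46 : mu (e 4) (e 6) = e 1 := by
    obtain ⟨h0, h1, h2, h3, h4, h5, h6, h7⟩ := mu_coords (e 4) (e 6)
    apply G_ext <;> simp [*, e_apply]
  have b57 : mu (e 5) (e 7) = e 2 := by
    obtain ⟨h0, h1, h2, h3, h4, h5, h6, h7⟩ := mu_coords (e 5) (e 7)
    apply G_ext <;> simp [*, e_apply]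
  have bB : mu (e 6) (e 5) = mu (e 4) (e 7) + (2 : ℂ) • e 3 := by
    obtain ⟨h0, h1, h2, h3, h4, h5, h6, h7⟩ := mu_coords (e 6) (e 5)
    obtain ⟨h0', h1', h2', h3', h4', h5', h6', h7'⟩ := mu_coords (e 4) (e 7)
    apply G_ext <;> simp [*, e_apply]
    norm_num
  have b3V : ∀ i : Fin 8, i = 4 ∨ i = 5 → mu (e 3) (e i) = (1/2 : ℂ) • e i := by
    intro i hi
    obtain ⟨h0, h1, h2, h3, h4, h5, h6, h7⟩ := mu_coords (e 3) (e i)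
    rcases hi with rfl | rfl <;> apply G_ext <;> simp [*, e_apply]
  have b3W : ∀ i : Fin 8, i = 6 ∨ i = 7 → mu (e 3) (e i) = (-1/2 : ℂ) • e i := by
    intro i hi
    obtain ⟨h0, h1, h2, h3, h4, h5, h6, h7⟩ := mu_coords (e 3) (e i)
    rcases hi with rfl | rfl <;> apply G_ext <;> simp [*, e_apply] <;> norm_num
  -- eigenvalue equations
  have eig : ∀ (i : Fin 8) (t : ℂ), 4 ≤ i.val → mu (e 3) (e i) = (t/2) • e i →
      l * A (e i) 4 = t * A (e i) 4 ∧ l * A (e i) 5 = t * A (e i) 5 ∧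
      l * A (e i) 6 = -t * A (e i) 6 ∧ l * A (e i) 7 = -t * A (e i) 7 := by
    intro i t hi h
    have h' := congrArg A h
    rw [hm, hB, map_smul] at h'
    obtain ⟨-, -, -, -, h4, h5, h6, h7⟩ := mu_coords (l • e 3) (A (e i))
    rw [h'] at h4 h5 h6 h7
    simp [e_apply] at h4 h5 h6 h7
    refine ⟨?_, ?_, ?_, ?_⟩
    · linear_combination -2*h4
    · linear_combination -2*h5
    · linear_combination 2*h6
    · linear_combination 2*h7
  have g4 := eig 4 1 (by decide) (b3V 4 (by simp))
  have g5 := eig 5 1 (by decide) (b3V 5 (by simp))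
  have g6 := eig 6 (-1) (by decide) (b3W 6 (by simp))
  have g7 := eig 7 (-1) (by decide) (b3W 7 (by simp))
  have ne4 : A (e 4) ≠ 0 := by
    intro h
    have := hinj (h.trans (map_zero A).symm)
    have := congrFun this 4
    simp [e_apply] at this
  have hl1 : l = 1 ∨ l = -1 := by
    by_contra hcon
    push Not at hcon
    obtain ⟨c1, c2⟩ := hcon
    obtain ⟨k0, k1, k2, k3⟩ := o4
    apply ne4
    apply G_ext <;> simp only [Pi.zero_apply] <;> grind
  -- bracket equations
  have X1 : mu (A (e 4)) (A (e 6)) 3 = 0 := by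
    rw [← hm, b46, ← b01, hm]
    exact mu_even_even _ _ (ev 0 (by decide)) (ev 1 (by decide))
  have X2 : mu (A (e 5)) (A (e 7)) 3 = 0 := by
    have : e 2 = - mu (e 0) (e 2) := by rw [b02, neg_neg]
    rw [← hm, b57, this, map_neg, hm, Pi.neg_apply,
      mu_even_even _ _ (ev 0 (by decide)) (ev 2 (by decide)), neg_zero]
  have XB : mu (A (e 6)) (A (e 5)) = mu (A (e 4)) (A (e 7)) + (2 * l) • e 3 := by
    rw [← hm, bB, map_add, hm, map_smul, hB, smul_smul]
  rw [(mu_coords _ _).2.2.2.1] at X1 X2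
  have XB0 := congrFun XB 0
  have XB1 := congrFun XB 1
  have XB2 := congrFun XB 2
  have XB3 := congrFun XB 3
  rw [Pi.add_apply, (mu_coords _ _).1, (mu_coords _ _).1] at XB0
  rw [Pi.add_apply, (mu_coords _ _).2.1, (mu_coords _ _).2.1] at XB1
  rw [Pi.add_apply, (mu_coords _ _).2.2.1, (mu_coords _ _).2.2.1] at XB2
  rw [Pi.add_apply, (mu_coords _ _).2.2.2.1, (mu_coords _ _).2.2.2.1] at XB3
  have two : ∀ z : ℂ, z = -z → z = 0 := fun z hz => by linear_combination hz / 2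
  obtain ⟨o40, o41, o42, o43⟩ := o4
  obtain ⟨o50, o51, o52, o53⟩ := o5
  obtain ⟨o60, o61, o62, o63⟩ := o6
  obtain ⟨o70, o71, o72, o73⟩ := o7
  rcases hl1 with h | h
  · rw [h] at g4 g5 g6 g7 XB0 XB1 XB2 XB3
    simp only [one_mul, neg_mul, neg_neg] at g4 g5 g6 g7
    have z1 := two _ g4.2.2.1
    have z2 := two _ g4.2.2.2
    have z3 := two _ g5.2.2.1
    have z4 := two _ g5.2.2.2
    have z5 := two _ g6.1
    have z6 := two _ g6.2.1
    have z7 := two _ g7.1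
    have z8 := two _ g7.2.1
    clear g4 g5 g6 g7
    simp [*, e_apply] at X1 X2 XB0 XB1 XB2 XB3
    obtain ⟨hk, r1, r2, r3, r4⟩ := alg (A (e 4) 4) (A (e 4) 5) (A (e 5) 4) (A (e 5) 5)
      (A (e 6) 6) (A (e 6) 7) (A (e 7) 6) (A (e 7) 7)
      (by linear_combination X1) (by linear_combination X2) (by linear_combination XB1)
      (by linear_combination XB2) (by linear_combination XB0) (by linear_combination XB3)
    refine ⟨A (e 4) 4, A (e 4) 5, A (e 5) 4, A (e 5) 5, 0, hk, fun _ => ?_, fun h => by simp at h⟩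
    rw [← r1, ← r2, ← r3, ← r4]
    clear r1 r2 r3 r4 X1 X2 XB XB0 XB1 XB2 XB3 bB b01 b02 b46 b57 b3V b3W eig hB hk two
    refine ⟨?_, ?_, ?_, ?_⟩ <;> apply G_ext <;> simp [*, e_apply]
  · rw [h] at g4 g5 g6 g7 XB0 XB1 XB2 XB3
    simp only [one_mul, neg_mul, neg_neg] at g4 g5 g6 g7
    have z1 := two _ g4.1.symm
    have z2 := two _ g4.2.1.symm
    have z3 := two _ g5.1.symm
    have z4 := two _ g5.2.1.symm
    have z5 := two _ g6.2.2.1.symm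
    have z6 := two _ g6.2.2.2.symm
    have z7 := two _ g7.2.2.1.symm
    have z8 := two _ g7.2.2.2.symm
    clear g4 g5 g6 g7
    simp [*, e_apply] at X1 X2 XB0 XB1 XB2 XB3
    obtain ⟨hk, r1, r2, r3, r4⟩ := alg (A (e 6) 4) (A (e 6) 5) (A (e 7) 4) (A (e 7) 5)
      (A (e 4) 6) (A (e 4) 7) (A (e 5) 6) (A (e 5) 7)
      (by linear_combination X1) (by linear_combination X2) (by linear_combination -XB1)
      (by linear_combination -XB2) (by linear_combination -XB0) (by linear_combination -XB3)
    refine ⟨A (e 6) 4, A (e 6) 5, A (e 7) 4, A (e 7) 5, 1, hk, fun h => by simp at h, fun _ => ?_⟩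
    rw [← r1, ← r2, ← r3, ← r4]
    clear r1 r2 r3 r4 X1 X2 XB XB0 XB1 XB2 XB3 bB b01 b02 b46 b57 b3V b3W eig hB hk two
    refine ⟨?_, ?_, ?_, ?_⟩ <;> apply G_ext <;> simp [*, e_apply]

end
end

section
/- For every a, b, c, d ∈ ℂ with k := ad − bc ≠ 0 and every m ∈ {0,1}, the linear map A : G → G defined by: A H = ((ad+bc) H + ac X₊ + bd X₋)/k, A X₊ = (2ab H + a² X₊ + b² X₋)/k, A X₋ = (2cd H + c² X₊ + d² X₋)/k, A B = (−1)^m B, and on the odd part (if m = 0): A V₊ = a V₊ + b V₋, A V₋ = c V₊ + d V₋, A W₊ = (a W₊ + b W₋)/k, A W₋ = (c W₊ + d W₋)/k, while (if m = 1): A V₊ = (a W₊ + b W₋)/k, A V₋ = (c W₊ + d W₋)/k, A W₊ = a V₊ + b V₋, A W₋ = c V₊ + d V₋, is an even automorphism of osp(2|2). Moreover, two such maps coincide only if they come from the same m and the same matrix (a,b;c,d), so the even automorphisms obtained this way are in bijection with GL(2,ℂ) × {0,1}. -/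
noncomputable section

open scoped BigOperators

/-- The matrix (in the basis `(H,X₊,X₋,B,V₊,V₋,W₊,W₋)`, columns = images of basis
vectors) of the candidate automorphism attached to `(a,b,c,d) ∈ GL(2,ℂ)` and `m ∈ {0,1}`. -/
def Amat (a b cc dd : ℂ) (m : Fin 2) : Matrix (Fin 8) (Fin 8) ℂ :=
  Matrix.of fun i j =>
    let k := a * dd - b * cc
    match i.val, j.val with
    | 0,0 => (a * dd + b * cc) / k
    | 1,0 => a * cc / k
    | 2,0 => b * dd / k
    | 0,1 => 2 * a * b / k
    | 1,1 => a ^ 2 / k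
    | 2,1 => b ^ 2 / k
    | 0,2 => 2 * cc * dd / k
    | 1,2 => cc ^ 2 / k
    | 2,2 => dd ^ 2 / k
    | 3,3 => (-1 : ℂ) ^ (m : ℕ)
    | 4,4 => if m = 0 then a else 0
    | 5,4 => if m = 0 then b else 0
    | 6,4 => if m = 1 then a / k else 0
    | 7,4 => if m = 1 then b / k else 0
    | 4,5 => if m = 0 then cc else 0
    | 5,5 => if m = 0 then dd else 0
    | 6,5 => if m = 1 then cc / k else 0
    | 7,5 => if m = 1 then dd / k else 0
    | 4,6 => if m = 1 then a else 0
    | 5,6 => if m = 1 then b else 0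
    | 6,6 => if m = 0 then a / k else 0
    | 7,6 => if m = 0 then b / k else 0
    | 4,7 => if m = 1 then cc else 0
    | 5,7 => if m = 1 then dd else 0
    | 6,7 => if m = 0 then cc / k else 0
    | 7,7 => if m = 0 then dd / k else 0
    | _,_ => 0

set_option maxHeartbeats 4000000 in
/-- The bracket in coordinates. -/
lemma mu_eq (u v : G) : mu u v = ![
    -2 * (u 1 * v 2) + 2 * (u 2 * v 1) + u 4 * v 7 + u 7 * v 4 + u 6 * v 5 + u 5 * v 6,
    u 0 * v 1 - u 1 * v 0 + u 4 * v 6 + u 6 * v 4,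
    - (u 0 * v 2) + u 2 * v 0 + u 5 * v 7 + u 7 * v 5,
    - (u 4 * v 7) - u 7 * v 4 + u 6 * v 5 + u 5 * v 6,
    (u 0 * v 4 - u 4 * v 0 + u 3 * v 4 - u 4 * v 3) / 2 - u 1 * v 5 + u 5 * v 1,
    (- (u 0 * v 5) + u 5 * v 0 + u 3 * v 5 - u 5 * v 3) / 2 + u 2 * v 4 - u 4 * v 2,
    (u 0 * v 6 - u 6 * v 0 - u 3 * v 6 + u 6 * v 3) / 2 - u 1 * v 7 + u 7 * v 1,
    (- (u 0 * v 7) + u 7 * v 0 - u 3 * v 7 + u 7 * v 3) / 2 + u 2 * v 6 - u 6 * v 2] := by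
  funext k
  fin_cases k <;> simp [mu, c, cNat, Fin.sum_univ_eight] <;> ring

/-- The map for `m = 0` in coordinates. -/
lemma A0_eq (a b cc dd : ℂ) (v : G) : Matrix.mulVecLin (Amat a b cc dd 0) v = ![
    ((a * dd + b * cc) * v 0 + 2 * a * b * v 1 + 2 * cc * dd * v 2) / (a * dd - b * cc),
    (a * cc * v 0 + a ^ 2 * v 1 + cc ^ 2 * v 2) / (a * dd - b * cc),
    (b * dd * v 0 + b ^ 2 * v 1 + dd ^ 2 * v 2) / (a * dd - b * cc),
    v 3,
    a * v 4 + cc * v 5,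
    b * v 4 + dd * v 5,
    (a * v 6 + cc * v 7) / (a * dd - b * cc),
    (b * v 6 + dd * v 7) / (a * dd - b * cc)] := by
  funext k
  fin_cases k <;>
    simp [Amat, Matrix.mulVec, dotProduct, Fin.sum_univ_eight] <;> ring

/-- The map for `m = 1` in coordinates. -/
lemma A1_eq (a b cc dd : ℂ) (v : G) : Matrix.mulVecLin (Amat a b cc dd 1) v = ![
    ((a * dd + b * cc) * v 0 + 2 * a * b * v 1 + 2 * cc * dd * v 2) / (a * dd - b * cc),
    (a * cc * v 0 + a ^ 2 * v 1 + cc ^ 2 * v 2) / (a * dd - b * cc),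
    (b * dd * v 0 + b ^ 2 * v 1 + dd ^ 2 * v 2) / (a * dd - b * cc),
    - v 3,
    a * v 6 + cc * v 7,
    b * v 6 + dd * v 7,
    (a * v 4 + cc * v 5) / (a * dd - b * cc),
    (b * v 4 + dd * v 5) / (a * dd - b * cc)] := by
  funext k
  fin_cases k <;>
    simp [Amat, Matrix.mulVec, dotProduct, Fin.sum_univ_eight] <;> ring

lemma A0_inj (a b cc dd : ℂ) (h : a * dd - b * cc ≠ 0) (v : G)
    (hv : Matrix.mulVecLin (Amat a b cc dd 0) v = 0) : v = 0 := by
  rw [A0_eq] at hv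
  have h0 := congrFun hv 0
  have h1 := congrFun hv 1
  have h2 := congrFun hv 2
  have h3 := congrFun hv 3
  have h4 := congrFun hv 4
  have h5 := congrFun hv 5
  have h6 := congrFun hv 6
  have h7 := congrFun hv 7
  simp [h] at h0 h1 h2 h3 h4 h5 h6 h7
  funext k
  fin_cases k
  · apply (mul_eq_zero.1 (?_ : (a * dd - b * cc) ^ 2 * v 0 = 0)).resolve_left (pow_ne_zero 2 h)
    linear_combination (a * dd + b * cc) * h0 - 2 * b * dd * h1 - 2 * a * cc * h2
  · apply (mul_eq_zero.1 (?_ : (a * dd - b * cc) ^ 2 * v 1 = 0)).resolve_left (pow_ne_zero 2 h)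
    linear_combination - cc * dd * h0 + dd ^ 2 * h1 + cc ^ 2 * h2
  · apply (mul_eq_zero.1 (?_ : (a * dd - b * cc) ^ 2 * v 2 = 0)).resolve_left (pow_ne_zero 2 h)
    linear_combination - a * b * h0 + b ^ 2 * h1 + a ^ 2 * h2
  · exact h3
  · apply (mul_eq_zero.1 (?_ : (a * dd - b * cc) * v 4 = 0)).resolve_left h
    linear_combination dd * h4 - cc * h5
  · apply (mul_eq_zero.1 (?_ : (a * dd - b * cc) * v 5 = 0)).resolve_left h
    linear_combination a * h5 - b * h4
  · apply (mul_eq_zero.1 (?_ : (a * dd - b * cc) * v 6 = 0)).resolve_left h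
    linear_combination dd * h6 - cc * h7
  · apply (mul_eq_zero.1 (?_ : (a * dd - b * cc) * v 7 = 0)).resolve_left h
    linear_combination a * h7 - b * h6

/-- The map for `m = 1` is injective: compare with the case `m = 0` after swapping. -/
lemma A1_inj (a b cc dd : ℂ) (h : a * dd - b * cc ≠ 0) (v : G)
    (hv : Matrix.mulVecLin (Amat a b cc dd 1) v = 0) : v = 0 := by
  have key := A0_inj a b cc dd h ![v 0, v 1, v 2, - v 3, v 6, v 7, v 4, v 5] (by
    rw [A1_eq] at hv
    rw [A0_eq]
    simpa using hv)
  funext k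
  fin_cases k
  · simpa using congrFun key 0
  · simpa using congrFun key 1
  · simpa using congrFun key 2
  · simpa using congrFun key 3
  · simpa using congrFun key 6
  · simpa using congrFun key 7
  · simpa using congrFun key 4
  · simpa using congrFun key 5

lemma bij_of (A : G →ₗ[ℂ] G) (hA : ∀ v, A v = 0 → v = 0) : Function.Bijective A := by
  have hi : Function.Injective A := (injective_iff_map_eq_zero A).2 hA
  exact ⟨hi, LinearMap.injective_iff_surjective.1 hi⟩

set_option maxHeartbeats 1000000 in
lemma A0_aut (a b cc dd : ℂ) (h : a * dd - b * cc ≠ 0) :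
    IsEvenAut (Matrix.mulVecLin (Amat a b cc dd 0)) := by
  refine ⟨bij_of _ (A0_inj a b cc dd h), ?_, ?_, ?_⟩
  · intro v hv
    have h4 := hv 4 (by decide)
    have h5 := hv 5 (by decide)
    have h6 := hv 6 (by decide)
    have h7 := hv 7 (by decide)
    rw [A0_eq]
    intro i hi
    fin_cases i <;> simp_all
  · intro v hv
    have h0 := hv 0 (by decide)
    have h1 := hv 1 (by decide)
    have h2 := hv 2 (by decide)
    have h3 := hv 3 (by decide)
    rw [A0_eq]
    intro i hi
    fin_cases i <;> simp_all
  · intro x y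
    rw [A0_eq, A0_eq, A0_eq, mu_eq, mu_eq]
    generalize hk : a * dd - b * cc = k at h
    funext j
    fin_cases j <;> simp <;> field_simp <;> subst hk <;> ring

set_option maxHeartbeats 1000000 in
lemma A1_aut (a b cc dd : ℂ) (h : a * dd - b * cc ≠ 0) :
    IsEvenAut (Matrix.mulVecLin (Amat a b cc dd 1)) := by
  refine ⟨bij_of _ (A1_inj a b cc dd h), ?_, ?_, ?_⟩
  · intro v hv
    have h4 := hv 4 (by decide)
    have h5 := hv 5 (by decide)
    have h6 := hv 6 (by decide)
    have h7 := hv 7 (by decide)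
    rw [A1_eq]
    intro i hi
    fin_cases i <;> simp_all
  · intro v hv
    have h0 := hv 0 (by decide)
    have h1 := hv 1 (by decide)
    have h2 := hv 2 (by decide)
    have h3 := hv 3 (by decide)
    rw [A1_eq]
    intro i hi
    fin_cases i <;> simp_all
  · intro x y
    rw [A1_eq, A1_eq, A1_eq, mu_eq, mu_eq]
    generalize hk : a * dd - b * cc = k at h
    funext j
    fin_cases j <;> simp <;> field_simp <;> subst hk <;> ring

/-- for every `(a,b,c,d)` with `ad − bc ≠ 0` and `m ∈ {0,1}` the map `Amat`
defines an even automorphism of `osp(2|2)`, and distinct parameters give distinct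
automorphisms (so these automorphisms are in bijection with `GL(2,ℂ) × {0,1}`). -/
theorem stmt5 (a b cc dd : ℂ) (m : Fin 2) (h : a * dd - b * cc ≠ 0) :
    IsEvenAut (Matrix.mulVecLin (Amat a b cc dd m)) ∧
    ∀ (a' b' cc' dd' : ℂ) (m' : Fin 2), a' * dd' - b' * cc' ≠ 0 →
      Matrix.mulVecLin (Amat a b cc dd m) = Matrix.mulVecLin (Amat a' b' cc' dd' m') →
      a = a' ∧ b = b' ∧ cc = cc' ∧ dd = dd' ∧ m = m' := by
  constructor
  · fin_cases m
    · exact A0_aut a b cc dd h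
    · exact A1_aut a b cc dd h
  · intro a' b' cc' dd' m' _ hE
    have hM : Amat a b cc dd m = Amat a' b' cc' dd' m' :=
      Matrix.toLin'.injective (by rw [Matrix.toLin'_apply', Matrix.toLin'_apply']; exact hE)
    have h33 : (-1 : ℂ) ^ (m : ℕ) = (-1 : ℂ) ^ (m' : ℕ) := congrFun (congrFun hM 3) 3
    have h44 : (if m = 0 then a else 0) = if m' = 0 then a' else 0 :=
      congrFun (congrFun hM 4) 4
    have h54 : (if m = 0 then b else 0) = if m' = 0 then b' else 0 :=
      congrFun (congrFun hM 5) 4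
    have h45 : (if m = 0 then cc else 0) = if m' = 0 then cc' else 0 :=
      congrFun (congrFun hM 4) 5
    have h55 : (if m = 0 then dd else 0) = if m' = 0 then dd' else 0 :=
      congrFun (congrFun hM 5) 5
    have h46 : (if m = 1 then a else 0) = if m' = 1 then a' else 0 :=
      congrFun (congrFun hM 4) 6
    have h56 : (if m = 1 then b else 0) = if m' = 1 then b' else 0 :=
      congrFun (congrFun hM 5) 6
    have h47 : (if m = 1 then cc else 0) = if m' = 1 then cc' else 0 :=
      congrFun (congrFun hM 4) 7
    have h57 : (if m = 1 then dd else 0) = if m' = 1 then dd' else 0 :=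
      congrFun (congrFun hM 5) 7
    clear hE hM
    fin_cases m <;> fin_cases m' <;> simp at h33 h44 h54 h45 h55 h46 h56 h47 h57
    · exact ⟨h44, h54, h45, h55, rfl⟩
    · norm_num [eq_neg_iff_add_eq_zero] at h33
    · norm_num [neg_eq_iff_add_eq_zero] at h33
    · exact ⟨h46, h56, h47, h57, rfl⟩

end
end

section
/- Let r ∈ G⊗G be an odd element, i.e. r ∈ (G₀⊗G₁) ⊕ (G₁⊗G₀), of the osp(2|2) Lie superalgebra G, and let δ_r(x) = x·r be its coboundary cobracket. If δ_r satisfies the parity condition, i.e. for every homogeneous x ∈ G of grade a, δ_r(x) lies in the sum of the subspaces G_b⊗G_c with b + c ≡ a (mod 2), then δ_r = 0. (Equivalently: for every homogeneous x of grade a, the component of x·r lying in the subspaces G_b⊗G_c with b + c ≡ a (mod 2) vanishes.) -/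
noncomputable section

open scoped BigOperators

/-- The action of the basis vector `gᵢ` on `G ⊗ G`:
`gᵢ·(u⊗v) = μ(gᵢ,u)⊗v + (−1)^{|i||u|} u⊗μ(gᵢ,v)`. -/
def actB (i : Fin 8) (r : TT) : TT :=
  fun p q => (∑ j, c i j p * r j q) + zz i p * ∑ j, c i j q * r p j

/-- The (bilinearly extended) action `x ↦ x·r` of `G` on `G ⊗ G`, as a linear map in `x`. -/
def actL (r : TT) : G →ₗ[ℂ] TT :=
  ∑ i : Fin 8, LinearMap.smulRight (LinearMap.proj i : G →ₗ[ℂ] ℂ) (actB i r)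

/-- The structure constants respect the grading. -/
theorem c_eq_zero_of_odd (i j k : Fin 8) (h : (gr i + gr j + gr k) % 2 = 1) : c i j k = 0 := by
  obtain ⟨i, hi⟩ := i
  obtain ⟨j, hj⟩ := j
  obtain ⟨k, hk⟩ := k
  simp only [gr] at h
  simp only [c]
  unfold cNat
  split <;> first | rfl | (exfalso; simp at h)

theorem gr_cases (i : Fin 8) : gr i = 0 ∨ gr i = 1 := by
  unfold gr
  split <;> simp

/-- On an odd tensor, the component of `gᵢ·r` of the wrong parity vanishes. -/
theorem actB_eq_zero (r : TT) (hodd : ∀ p q : Fin 8, gr p = gr q → r p q = 0)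
    (i p q : Fin 8) (h : (gr i + gr p + gr q) % 2 = 0) : actB i r p q = 0 := by
  have h1 : ∀ j, c i j p * r j q = 0 := by
    intro j
    by_cases hj : gr j = gr q
    · rw [hodd j q hj, mul_zero]
    · rw [c_eq_zero_of_odd i j p, zero_mul]
      rcases gr_cases j with a | a <;> rcases gr_cases q with b | b <;> omega
  have h2 : ∀ j, c i j q * r p j = 0 := by
    intro j
    by_cases hj : gr p = gr j
    · rw [hodd p j hj, mul_zero]
    · rw [c_eq_zero_of_odd i j q, zero_mul]
      rcases gr_cases j with a | a <;> rcases gr_cases p with b | b <;> omega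
  simp [actB, h1, h2]

theorem actL_apply (r : TT) (x : G) (p q : Fin 8) :
    actL r x p q = ∑ i, x i * actB i r p q := by
  simp [actL, LinearMap.sum_apply, Finset.sum_apply]

theorem actL_e (r : TT) (i p q : Fin 8) : actL r (e i) p q = actB i r p q := by
  simp [actL_apply, e, Pi.single_apply]

/-- if `r ∈ (G₀⊗G₁) ⊕ (G₁⊗G₀)` is odd and the coboundary `δ_r(x) = x·r`
satisfies the parity condition, then `δ_r = 0`. -/
theorem stmt6 (r : TT) (hodd : ∀ p q : Fin 8, gr p = gr q → r p q = 0)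
    (hpar0 : ∀ x, isEven x → ∀ p q : Fin 8, (gr p + gr q) % 2 = 1 → actL r x p q = 0)
    (hpar1 : ∀ x, isOdd x → ∀ p q : Fin 8, (gr p + gr q) % 2 = 0 → actL r x p q = 0) :
    ∀ x : G, actL r x = 0 := by
  intro x
  funext p q
  rw [actL_apply]
  refine Finset.sum_eq_zero fun i _ => ?_
  have key : actB i r p q = 0 := by
    by_cases h : (gr i + gr p + gr q) % 2 = 0
    · exact actB_eq_zero r hodd i p q h
    · rw [← actL_e]
      by_cases hi : i.val < 4
      · have hg : gr i = 0 := by simp [gr, hi]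
        refine hpar0 _ (fun j hj => ?_) p q (by omega)
        have : j ≠ i := by rintro rfl; omega
        simp [e, this]
      · have hg : gr i = 1 := by simp [gr, hi]
        refine hpar1 _ (fun j hj => ?_) p q (by omega)
        have : j ≠ i := by rintro rfl; omega
        simp [e, this]
  rw [key, mul_zero]

end
end

section
/- For every x ∈ ℂ, the element r = x(h⊗e − e⊗h) + (b⊗e − e⊗b) of M₂(ℂ)⊗M₂(ℂ) (corresponding to the r-matrix x·H∧X₊ + B∧X₊ on the bosonic subalgebra gl(2) of osp(2|2)) satisfies the classical Yang–Baxter equation: [r₁₂, r₁₃] + [r₁₂, r₂₃] + [r₁₃, r₂₃] = 0 in M₂(ℂ)⊗M₂(ℂ)⊗M₂(ℂ). -/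
noncomputable section

open scoped TensorProduct

abbrev M2 := Matrix (Fin 2) (Fin 2) ℂ

/-- `h = ½(E₁₁ − E₂₂)`. -/
def hMat : M2 := !![1/2, 0; 0, -1/2]

/-- `e = E₁₂`. -/
def eMat : M2 := !![0, 1; 0, 0]

/-- `b = ½(E₁₁ + E₂₂)`. -/
def bMat : M2 := !![1/2, 0; 0, 1/2]

/-- The same identity in an arbitrary algebra. -/
theorem cybe_generic {K A : Type*} [Field K] [Ring A] [Algebra K A] (x c d : K) (h e b : A)
    (he : h * e = c • e) (eh : e * h = (-c) • e) (ee : e * e = 0) (hb : b = d • (1 : A))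
    (hc : c + c = 1) :
    let r12 : A ⊗[K] A ⊗[K] A :=
      x • (h ⊗ₜ[K] e ⊗ₜ[K] (1 : A) - e ⊗ₜ[K] h ⊗ₜ[K] (1 : A))
        + (b ⊗ₜ[K] e ⊗ₜ[K] (1 : A) - e ⊗ₜ[K] b ⊗ₜ[K] (1 : A))
    let r13 : A ⊗[K] A ⊗[K] A :=
      x • (h ⊗ₜ[K] (1 : A) ⊗ₜ[K] e - e ⊗ₜ[K] (1 : A) ⊗ₜ[K] h)
        + (b ⊗ₜ[K] (1 : A) ⊗ₜ[K] e - e ⊗ₜ[K] (1 : A) ⊗ₜ[K] b)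
    let r23 : A ⊗[K] A ⊗[K] A :=
      x • ((1 : A) ⊗ₜ[K] h ⊗ₜ[K] e - (1 : A) ⊗ₜ[K] e ⊗ₜ[K] h)
        + ((1 : A) ⊗ₜ[K] b ⊗ₜ[K] e - (1 : A) ⊗ₜ[K] e ⊗ₜ[K] b)
    (r12 * r13 - r13 * r12) + (r12 * r23 - r23 * r12) + (r13 * r23 - r23 * r13) = 0 := by
  intro r12 r13 r23
  simp only [r12, r13, r23, hb, mul_add, add_mul, mul_sub, sub_mul, smul_mul_assoc, mul_smul_comm,
    smul_add, smul_sub, Algebra.TensorProduct.tmul_mul_tmul, he, eh, ee, mul_one, one_mul,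
    TensorProduct.smul_tmul', TensorProduct.tmul_smul, TensorProduct.zero_tmul,
    TensorProduct.tmul_zero, smul_zero, smul_smul]
  simp only [← TensorProduct.smul_tmul']
  module

/-- `r = x(h⊗e − e⊗h) + (b⊗e − e⊗b)` satisfies the classical Yang–Baxter
equation in `M₂(ℂ)⊗M₂(ℂ)⊗M₂(ℂ)` for every `x ∈ ℂ`. -/
theorem stmt14 (x : ℂ) :
    let r12 : M2 ⊗[ℂ] M2 ⊗[ℂ] M2 :=
      x • (hMat ⊗ₜ[ℂ] eMat ⊗ₜ[ℂ] (1 : M2) - eMat ⊗ₜ[ℂ] hMat ⊗ₜ[ℂ] (1 : M2))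
        + (bMat ⊗ₜ[ℂ] eMat ⊗ₜ[ℂ] (1 : M2) - eMat ⊗ₜ[ℂ] bMat ⊗ₜ[ℂ] (1 : M2))
    let r13 : M2 ⊗[ℂ] M2 ⊗[ℂ] M2 :=
      x • (hMat ⊗ₜ[ℂ] (1 : M2) ⊗ₜ[ℂ] eMat - eMat ⊗ₜ[ℂ] (1 : M2) ⊗ₜ[ℂ] hMat)
        + (bMat ⊗ₜ[ℂ] (1 : M2) ⊗ₜ[ℂ] eMat - eMat ⊗ₜ[ℂ] (1 : M2) ⊗ₜ[ℂ] bMat)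
    let r23 : M2 ⊗[ℂ] M2 ⊗[ℂ] M2 :=
      x • ((1 : M2) ⊗ₜ[ℂ] hMat ⊗ₜ[ℂ] eMat - (1 : M2) ⊗ₜ[ℂ] eMat ⊗ₜ[ℂ] hMat)
        + ((1 : M2) ⊗ₜ[ℂ] bMat ⊗ₜ[ℂ] eMat - (1 : M2) ⊗ₜ[ℂ] eMat ⊗ₜ[ℂ] bMat)
    (r12 * r13 - r13 * r12) + (r12 * r23 - r23 * r12) + (r13 * r23 - r23 * r13) = 0 := by
  have he : hMat * eMat = (1/2 : ℂ) • eMat := by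
    ext i j; fin_cases i <;> fin_cases j <;> simp [hMat, eMat]
  have eh : eMat * hMat = (-(1/2) : ℂ) • eMat := by
    ext i j; fin_cases i <;> fin_cases j <;> simp [hMat, eMat]; norm_num
  have ee : eMat * eMat = 0 := by
    ext i j; fin_cases i <;> fin_cases j <;> simp [eMat]
  have hb : bMat = (1/2 : ℂ) • (1 : M2) := by
    ext i j; fin_cases i <;> fin_cases j <;> simp [bMat]
  exact cybe_generic x (1/2) (1/2) hMat eMat bMat he eh ee hb (by norm_num)

end
end
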